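/- There exists a finite constant C such that for all integers h ≥ 1 and k ≥ 0, if the chain Y starts at k then E[σ_h ∧ ω] ≤ C·h². -/

import Mathlib

open MeasureTheory ProbabilityTheory
open scoped ENNReal

/-- π(0,j) := δ_{0,j} and, for i > 0, π(i,j) := 2^{−i−j}·(i+j−1)!/((i−1)!·j!). -/
noncomputable def piGW (i j : ℕ) : ℝ :=
  if i = 0 then (if j = 0 then 1 else 0)
  else (2 : ℝ) ^ (-(i : ℝ) - (j : ℝ)) * (Nat.factorial (i + j - 1)) /
    ((Nat.factorial (i - 1)) * (Nat.factorial j))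

/-- `Y` is a Markov chain with transition probabilities `trans` started at `k`:
`P(Y_0 = k) = 1` and
`P(Y_0 = k_0, …, Y_n = k_n) = P(Y_0 = k_0) · ∏_{0 ≤ i < n} trans(k_i, k_{i+1})`. -/
def IsMarkovChainFrom {Ω : Type*} [MeasurableSpace Ω] (P : Measure Ω)
    (Y : ℕ → Ω → ℕ) (trans : ℕ → ℕ → ℝ) (k : ℕ) : Prop :=
  (∀ t, Measurable (Y t)) ∧
    ∀ (n : ℕ) (ks : ℕ → ℕ),
      P {ω | ∀ i ≤ n, Y i ω = ks i} =
        ENNReal.ofReal ((if ks 0 = k then 1 else 0) *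
          ∏ i ∈ Finset.range n, trans (ks i) (ks (i + 1)))

/-- `σ_h := inf{t ≥ 0 : Y_t ≥ h}` (with value `∞` if there is no such `t`). -/
noncomputable def sigma' {Ω : Type*} (Y : ℕ → Ω → ℕ) (h : ℕ) (ω : Ω) : ℕ∞ :=
  sInf ((↑) '' {t : ℕ | h ≤ Y t ω} : Set ℕ∞)

/-- `ω := inf{t ≥ 0 : Y_t = 0}` (with value `∞` if there is no such `t`). -/
noncomputable def omegaStop {Ω : Type*} (Y : ℕ → Ω → ℕ) (ω : Ω) : ℕ∞ :=
  sInf ((↑) '' {t : ℕ | Y t ω = 0} : Set ℕ∞)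

/-- The generating function of the transition `piGW i`: a sum of `i` independent geometric
variables of parameter `1/2`. -/
lemma hasSum_piGW_mul_pow {i : ℕ} (hi : 0 < i) {s : ℝ} (hs0 : 0 ≤ s) (hs1 : s ≤ 1) :
    HasSum (fun j => piGW i j * s ^ j) (((2 - s) ^ i)⁻¹) := by
  obtain ⟨m, rfl⟩ : ∃ m, i = m + 1 := ⟨i - 1, by omega⟩
  have hr : ‖s / 2‖ < 1 := by
    rw [Real.norm_of_nonneg (by positivity)]
    linarith
  have key := (hasSum_choose_mul_geometric_of_norm_lt_one m hr).mul_left (((2 : ℝ) ^ (m + 1))⁻¹)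
  have hterm : ∀ j, piGW (m + 1) j * s ^ j =
      ((2 : ℝ) ^ (m + 1))⁻¹ * (((j + m).choose m : ℝ) * (s / 2) ^ j) := by
    intro j
    have hpow : (2 : ℝ) ^ (-((m + 1 : ℕ) : ℝ) - (j : ℝ)) = ((2 : ℝ) ^ (m + 1))⁻¹ * (2 ^ j)⁻¹ := by
      rw [Real.rpow_sub two_pos, Real.rpow_neg two_pos.le, Real.rpow_natCast, Real.rpow_natCast,
        div_eq_mul_inv]
    have hch : ((j + m).choose m : ℝ) = (j + m).factorial / (m.factorial * j.factorial) := by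
      rw [Nat.cast_choose ℝ (Nat.le_add_left m j), Nat.add_sub_cancel]
    have hidx : m + 1 + j - 1 = j + m := by omega
    rw [piGW, if_neg (Nat.succ_ne_zero m), hpow, hch, hidx, Nat.add_sub_cancel, div_pow]
    ring
  rw [show (2 - s) = 2 * (1 - s / 2) by ring, mul_pow, mul_inv, ← one_div ((1 - s / 2) ^ _)]
  rw [funext hterm]
  exact key

lemma piGW_nonneg (i j : ℕ) : 0 ≤ piGW i j := by
  unfold piGW
  split_ifs <;> positivity

/-- The bounded Lyapunov function `j ↦ 3h²(1 - (1 - 1/h)^j)`. -/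
noncomputable def lyapunovGW (h j : ℕ) : ℝ :=
  3 * (h : ℝ) ^ 2 * (1 - (1 - (h : ℝ)⁻¹) ^ j)

lemma one_sub_inv_natCast_mem_Icc (h : ℕ) : 1 - (h : ℝ)⁻¹ ∈ Set.Icc (0 : ℝ) 1 := by
  have h1 : (h : ℝ)⁻¹ ≤ 1 := Nat.cast_inv_le_one h
  have h0 : 0 ≤ (h : ℝ)⁻¹ := by positivity
  constructor <;> linarith

lemma lyapunovGW_nonneg (h j : ℕ) : 0 ≤ lyapunovGW h j := by
  have hs := one_sub_inv_natCast_mem_Icc h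
  exact mul_nonneg (by positivity) (sub_nonneg.2 (pow_le_one₀ hs.1 hs.2))

lemma lyapunovGW_le (h j : ℕ) : lyapunovGW h j ≤ 3 * (h : ℝ) ^ 2 := by
  have hs := pow_nonneg (one_sub_inv_natCast_mem_Icc h).1 j
  exact mul_le_of_le_one_right (by positivity) (by linarith)

lemma hasSum_piGW_mul_lyapunovGW (h : ℕ) {i : ℕ} (hi : 0 < i) :
    HasSum (fun j => piGW i j * lyapunovGW h j)
      (3 * (h : ℝ) ^ 2 * (1 - ((1 + (h : ℝ)⁻¹) ^ i)⁻¹)) := by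
  have hs := one_sub_inv_natCast_mem_Icc h
  have h1 := hasSum_piGW_mul_pow hi zero_le_one le_rfl
  have h2 := hasSum_piGW_mul_pow hi hs.1 hs.2
  have hterm : ∀ j, piGW i j * lyapunovGW h j =
      3 * (h : ℝ) ^ 2 * (piGW i j * 1 ^ j - piGW i j * (1 - (h : ℝ)⁻¹) ^ j) := by
    intro j
    simp only [lyapunovGW, one_pow]
    ring
  have hval : 1 - ((1 + (h : ℝ)⁻¹) ^ i)⁻¹ =
      ((2 - 1 : ℝ) ^ i)⁻¹ - ((2 - (1 - (h : ℝ)⁻¹)) ^ i)⁻¹ := by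
    rw [show (2 - 1 : ℝ) = 1 by norm_num, one_pow, inv_one,
      show 2 - (1 - (h : ℝ)⁻¹) = 1 + (h : ℝ)⁻¹ by ring]
  rw [funext hterm, hval]
  exact (h1.sub h2).mul_left (3 * (h : ℝ) ^ 2)

/-- The Lyapunov function decreases in mean by at least one on `(0, h)`. -/
lemma one_add_le_lyapunovGW {h i : ℕ} (hi : 0 < i) (hih : i < h) :
    1 + 3 * (h : ℝ) ^ 2 * (1 - ((1 + (h : ℝ)⁻¹) ^ i)⁻¹) ≤ lyapunovGW h i := by
  have hh : (0 : ℝ) < h := by exact_mod_cast hi.trans hih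
  unfold lyapunovGW
  set x : ℝ := (h : ℝ)⁻¹ with hx
  have hx0 : 0 < x := inv_pos.2 hh
  have hx1 : x ≤ 1 := Nat.cast_inv_le_one h
  have hxi : i * x ≤ 1 := by
    rw [hx, ← div_eq_mul_inv, div_le_one hh]
    exact_mod_cast hih.le
  have hup : (1 + x) ^ i ≤ 3 := by
    calc (1 + x) ^ i ≤ Real.exp x ^ i :=
          pow_le_pow_left₀ (by positivity) (by linarith [Real.add_one_le_exp x]) i
      _ = Real.exp (i * x) := (Real.exp_nat_mul x i).symm
      _ ≤ Real.exp 1 := Real.exp_le_exp.2 hxi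
      _ ≤ 3 := by linarith [Real.exp_one_lt_d9]
  have hpos : 0 < (1 + x) ^ i := by positivity
  have hlow : (1 - x) ^ i * (1 + x) ^ i ≤ 1 - x ^ 2 := by
    rw [← mul_pow, show (1 - x) * (1 + x) = 1 - x ^ 2 by ring]
    exact pow_le_of_le_one (by nlinarith) (by nlinarith) hi.ne'
  have hgap : x ^ 2 ≤ 3 * (((1 + x) ^ i)⁻¹ - (1 - x) ^ i) := by
    have : ((1 + x) ^ i)⁻¹ - (1 - x) ^ i
        = ((1 + x) ^ i)⁻¹ * (1 - (1 - x) ^ i * (1 + x) ^ i) := by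
      field_simp
    rw [this]
    have hinv : 3⁻¹ ≤ ((1 + x) ^ i)⁻¹ := inv_anti₀ hpos hup
    nlinarith [mul_le_mul hinv (show x ^ 2 ≤ 1 - (1 - x) ^ i * (1 + x) ^ i by linarith)
      (by positivity) (by positivity)]
  have hhx : (h : ℝ) ^ 2 * x ^ 2 = 1 := by
    rw [← mul_pow, hx, mul_inv_cancel₀ hh.ne', one_pow]
  nlinarith [mul_le_mul_of_nonneg_left hgap (sq_nonneg (h : ℝ))]

lemma one_add_tsum_piGW_mul_lyapunovGW_le {h i : ℕ} (hi : 0 < i) (hih : i < h) :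
    1 + ∑' j, ENNReal.ofReal (piGW i j) * ENNReal.ofReal (lyapunovGW h j)
      ≤ ENNReal.ofReal (lyapunovGW h i) := by
  have hs := hasSum_piGW_mul_lyapunovGW h hi
  have hnn : ∀ j, 0 ≤ piGW i j * lyapunovGW h j := fun j =>
    mul_nonneg (piGW_nonneg i j) (lyapunovGW_nonneg h j)
  simp_rw [← ENNReal.ofReal_mul (piGW_nonneg i _)]
  rw [← ENNReal.ofReal_tsum_of_nonneg hnn hs.summable, hs.tsum_eq, ← ENNReal.ofReal_one,
    ← ENNReal.ofReal_add zero_le_one (hs.nonneg hnn)]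
  exact ENNReal.ofReal_le_ofReal (one_add_le_lyapunovGW hi hih)

section MarkovChain

variable {Ω : Type*} [MeasurableSpace Ω] {P : Measure Ω} {Y : ℕ → Ω → ℕ}

lemma IsMarkovChainFrom.measure_path_succ {trans : ℕ → ℕ → ℝ} {k : ℕ}
    (hY : IsMarkovChainFrom P Y trans k) (htrans : ∀ i j, 0 ≤ trans i j)
    (t : ℕ) (ks : ℕ → ℕ) (j : ℕ) :
    P {ω | ∀ i ≤ t + 1, Y i ω = Function.update ks (t + 1) j i} =
      P {ω | ∀ i ≤ t, Y i ω = ks i} * ENNReal.ofReal (trans (ks t) j) := by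
  have hprod : ∏ i ∈ Finset.range t, trans (Function.update ks (t + 1) j i)
      (Function.update ks (t + 1) j (i + 1)) = ∏ i ∈ Finset.range t, trans (ks i) (ks (i + 1)) := by
    refine Finset.prod_congr rfl fun i hi => ?_
    have := Finset.mem_range.1 hi
    rw [Function.update_of_ne (by omega), Function.update_of_ne (by omega)]
  rw [hY.2, hY.2, ← ENNReal.ofReal_mul, Finset.prod_range_succ, hprod, Function.update_self,
    Function.update_of_ne (by omega), Function.update_of_ne (by omega), mul_assoc]
  exact mul_nonneg (by split_ifs <;> simp) (Finset.prod_nonneg fun _ _ => htrans _ _)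

/-- Given its path up to time `t`, the expected time the chain spends in `(0, h)` before leaving it
is at most the Lyapunov function at the current position. -/
lemma IsMarkovChainFrom.sum_measure_path_inter_le {k : ℕ} (hY : IsMarkovChainFrom P Y piGW k)
    (h n t : ℕ) (ks : ℕ → ℕ) :
    ∑ u ∈ Finset.range n, P ({ω | ∀ i ≤ t, Y i ω = ks i} ∩
        {ω | ∀ s ≤ u, 0 < Y (t + s) ω ∧ Y (t + s) ω < h}) ≤
      P {ω | ∀ i ≤ t, Y i ω = ks i} * ENNReal.ofReal (lyapunovGW h (ks t)) := by
  induction n generalizing t ks with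
  | zero => simp
  | succ n ih =>
    by_cases hks : 0 < ks t ∧ ks t < h
    · rw [Finset.sum_range_succ']
      have hstep : ∀ u, P ({ω | ∀ i ≤ t, Y i ω = ks i} ∩
          {ω | ∀ s ≤ u + 1, 0 < Y (t + s) ω ∧ Y (t + s) ω < h}) ≤
          ∑' j, P ({ω | ∀ i ≤ t + 1, Y i ω = Function.update ks (t + 1) j i} ∩
            {ω | ∀ s ≤ u, 0 < Y (t + 1 + s) ω ∧ Y (t + 1 + s) ω < h}) := by
        intro u
        refine (measure_mono fun ω hω => ?_).trans (measure_iUnion_le _)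
        refine Set.mem_iUnion.2 ⟨Y (t + 1) ω, fun i hi => ?_, fun s hs => ?_⟩
        · rcases hi.lt_or_eq with hi | rfl
          · rw [Function.update_of_ne hi.ne]
            exact hω.1 i (by omega)
          · rw [Function.update_self]
        · have := hω.2 (s + 1) (by omega)
          rwa [show t + (s + 1) = t + 1 + s by omega] at this
      calc _ ≤ ∑ u ∈ Finset.range n,
            ∑' j, P ({ω | ∀ i ≤ t + 1, Y i ω = Function.update ks (t + 1) j i} ∩
            {ω | ∀ s ≤ u, 0 < Y (t + 1 + s) ω ∧ Y (t + 1 + s) ω < h}) +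
              P {ω | ∀ i ≤ t, Y i ω = ks i} :=
            add_le_add (Finset.sum_le_sum fun u _ => hstep u) (measure_mono Set.inter_subset_left)
        _ = ∑' j, ∑ u ∈ Finset.range n,
            P ({ω | ∀ i ≤ t + 1, Y i ω = Function.update ks (t + 1) j i} ∩
            {ω | ∀ s ≤ u, 0 < Y (t + 1 + s) ω ∧ Y (t + 1 + s) ω < h}) +
              P {ω | ∀ i ≤ t, Y i ω = ks i} := by
            rw [Summable.tsum_finsetSum fun _ _ => ENNReal.summable]
        _ ≤ ∑' j, P {ω | ∀ i ≤ t, Y i ω = ks i} *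
              (ENNReal.ofReal (piGW (ks t) j) * ENNReal.ofReal (lyapunovGW h j)) +
              P {ω | ∀ i ≤ t, Y i ω = ks i} := by
            gcongr with j
            refine (ih (t + 1) (Function.update ks (t + 1) j)).trans_eq ?_
            rw [hY.measure_path_succ piGW_nonneg, Function.update_self, mul_assoc]
        _ = P {ω | ∀ i ≤ t, Y i ω = ks i} *
              (1 + ∑' j, ENNReal.ofReal (piGW (ks t) j) * ENNReal.ofReal (lyapunovGW h j)) := by
            rw [ENNReal.tsum_mul_left, mul_add, mul_one, add_comm]
        _ ≤ _ := by
            gcongr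
            exact one_add_tsum_piGW_mul_lyapunovGW_le hks.1 hks.2
    · refine (Finset.sum_eq_zero fun u _ => ?_).trans_le zero_le
      refine measure_mono_null (fun ω hω => hks ?_) measure_empty
      have := hω.2 0 (Nat.zero_le u)
      rwa [add_zero, hω.1 t le_rfl] at this

end MarkovChain

lemma min_sigma'_omegaStop_le_of_exit {Ω : Type*} {Y : ℕ → Ω → ℕ} {h u : ℕ} {ω : Ω}
    (hu : ¬ (0 < Y u ω ∧ Y u ω < h)) : min (sigma' Y h ω) (omegaStop Y ω) ≤ u := by
  by_cases h0 : Y u ω = 0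
  · exact (min_le_right _ _).trans (sInf_le ⟨u, h0, rfl⟩)
  · exact (min_le_left _ _).trans
      (sInf_le ⟨u, not_lt.1 fun hlt => hu ⟨Nat.pos_of_ne_zero h0, hlt⟩, rfl⟩)

/-- The exit time of `(0, h)` is at most the sum over `u` of the indicators of not having left
`(0, h)` up to time `u`. -/
lemma min_sigma'_omegaStop_le_tsum {Ω : Type*} (Y : ℕ → Ω → ℕ) (h : ℕ) (ω : Ω) :
    ((min (sigma' Y h ω) (omegaStop Y ω) : ℕ∞) : ℝ≥0∞) ≤
      ∑' u, {ω | ∀ s ≤ u, 0 < Y s ω ∧ Y s ω < h}.indicator 1 ω := by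
  classical
  by_cases hall : ∀ u, 0 < Y u ω ∧ Y u ω < h
  · have : ∀ u, {ω | ∀ s ≤ u, 0 < Y s ω ∧ Y s ω < h}.indicator (1 : Ω → ℝ≥0∞) ω = 1 := fun u =>
      Set.indicator_of_mem (Set.mem_ofPred.2 fun s _ => hall s) _
    simp [this]
  · have hex := not_forall.1 hall
    calc ((min (sigma' Y h ω) (omegaStop Y ω) : ℕ∞) : ℝ≥0∞)
        ≤ ((Nat.find hex : ℕ∞) : ℝ≥0∞) :=
          ENat.toENNReal_le.2 (min_sigma'_omegaStop_le_of_exit (Nat.find_spec hex))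
      _ = ∑ u ∈ Finset.range (Nat.find hex), 1 := by simp
      _ = ∑ u ∈ Finset.range (Nat.find hex),
            {ω | ∀ s ≤ u, 0 < Y s ω ∧ Y s ω < h}.indicator 1 ω := by
          refine Finset.sum_congr rfl fun u hu => Eq.symm ?_
          refine Set.indicator_of_mem (Set.mem_ofPred.2 fun s hs => ?_) (1 : Ω → ℝ≥0∞)
          exact not_not.1 (Nat.find_min hex (hs.trans_lt (Finset.mem_range.1 hu)))
      _ ≤ _ := ENNReal.sum_le_tsum _

/-- There exists a finite constant C such that for all integers h ≥ 1 and
k ≥ 0, if the chain Y starts at k then E[σ_h ∧ ω] ≤ C·h². -/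
theorem stmt_13 :
    ∃ C : ℝ,
      ∀ (h k : ℕ), 1 ≤ h →
        ∀ (Ω : Type) (_ : MeasurableSpace Ω) (P : Measure Ω) (Y : ℕ → Ω → ℕ),
          IsProbabilityMeasure P → IsMarkovChainFrom P Y piGW k →
          ∫⁻ ω, ((min (sigma' Y h ω) (omegaStop Y ω) : ℕ∞) : ℝ≥0∞) ∂P ≤
            ENNReal.ofReal (C * (h : ℝ) ^ 2) := by
  refine ⟨3, fun h k _ Ω _ P Y hP hY => ?_⟩
  have hmeas : ∀ u, MeasurableSet {ω | ∀ s ≤ u, 0 < Y s ω ∧ Y s ω < h} := by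
    intro u
    have : {ω | ∀ s ≤ u, 0 < Y s ω ∧ Y s ω < h} = ⋂ s, ⋂ (_ : s ≤ u), Y s ⁻¹' Set.Ioo 0 h := by
      ext ω
      simp
    rw [this]
    exact .iInter fun s => .iInter fun _ => hY.1 s (measurableSet_Ioo)
  have hstart : P {ω | ∀ i ≤ 0, Y i ω = k} = 1 := by
    simpa using hY.2 0 fun _ => k
  calc ∫⁻ ω, ((min (sigma' Y h ω) (omegaStop Y ω) : ℕ∞) : ℝ≥0∞) ∂P
      ≤ ∫⁻ ω, ∑' u, {ω | ∀ s ≤ u, 0 < Y s ω ∧ Y s ω < h}.indicator 1 ω ∂P :=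
        lintegral_mono fun ω => min_sigma'_omegaStop_le_tsum Y h ω
    _ = ∑' u, P {ω | ∀ s ≤ u, 0 < Y s ω ∧ Y s ω < h} := by
        rw [lintegral_tsum fun u => (measurable_one.indicator (hmeas u)).aemeasurable]
        simp_rw [lintegral_indicator_one (hmeas _)]
    _ ≤ ENNReal.ofReal (3 * (h : ℝ) ^ 2) := by
        refine ENNReal.tsum_le_of_sum_range_le fun n => ?_
        calc ∑ u ∈ Finset.range n, P {ω | ∀ s ≤ u, 0 < Y s ω ∧ Y s ω < h}
            = ∑ u ∈ Finset.range n, P ({ω | ∀ i ≤ 0, Y i ω = k} ∩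
                {ω | ∀ s ≤ u, 0 < Y (0 + s) ω ∧ Y (0 + s) ω < h}) := by
              refine Finset.sum_congr rfl fun u _ => measure_congr ?_
              have hae : ∀ᵐ ω ∂P, ∀ i ≤ 0, Y i ω = k := by
                refine (prob_compl_eq_zero_iff ?_).2 hstart
                convert hY.1 0 (measurableSet_singleton k) using 1
                ext ω
                simp
              filter_upwards [hae] with ω hω
              simp only [zero_add]
              exact propext ⟨fun hS => ⟨hω, hS⟩, fun hS => hS.2⟩
          _ ≤ P {ω | ∀ i ≤ 0, Y i ω = k} * ENNReal.ofReal (lyapunovGW h k) :=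
              hY.sum_measure_path_inter_le h n 0 fun _ => k
          _ ≤ ENNReal.ofReal (3 * (h : ℝ) ^ 2) := by
              rw [hstart, one_mul]
              exact ENNReal.ofReal_le_ofReal (lyapunovGW_le h k)
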